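/- In ℝ⁷ as above, the convex cone generated by Σ equals {v ∈ ℝ⁷ : q(v,ξ) ≥ 0 for all ξ ∈ Ξ}, and the convex cone generated by Ξ equals {v ∈ ℝ⁷ : q(v,s) ≥ 0 for all s ∈ Σ}; that is, the cones generated by Σ and by Ξ are dual to each other with respect to q. (This is the computational core of the proposition that the effective cone NE¹(F_σ) of a fixed-point divisor F_σ ⊂ M̄_{0,6} is generated by the nine (−1)-curve classes g_{ij} and h − g_{ij} − g_{kl} together with the four (−2)-curve classes h − g_{ij} − g_{ik} − g_{il}.) -/

import Mathlib

noncomputable section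

/-- The pullback `h` of the hyperplane class on the blow-up `F` of `ℙ²`
at the six intersection points of four general lines. -/
def h7 : Fin 7 → ℝ := Pi.single 0 1

/-- Index (in `Fin 7`) of the exceptional class attached to the pair `{i,j} ⊂ {1,2,3,4}`
(written `0`-based, assuming `i < j`). -/
def gIdx : ℕ → ℕ → Fin 7
  | 0, 1 => 1
  | 0, 2 => 2
  | 0, 3 => 3
  | 1, 2 => 4
  | 1, 3 => 5
  | 2, 3 => 6
  | _, _ => 0

/-- The exceptional class `g_{ij}` over the point `q_{ij} = ℓᵢ ∩ ℓⱼ` (for `i ≠ j`). -/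
def g (i j : Fin 4) : Fin 7 → ℝ :=
  Pi.single (if i.val < j.val then gIdx i.val j.val else gIdx j.val i.val) 1

/-- The intersection form on the blow-up: `q(h,h) = 1`, `q(g_{ij},g_{ij}) = -1`,
distinct basis vectors orthogonal. -/
def q7 (v w : Fin 7 → ℝ) : ℝ :=
  v 0 * w 0 - v 1 * w 1 - v 2 * w 2 - v 3 * w 3 - v 4 * w 4 - v 5 * w 5 - v 6 * w 6

def Distinct4 (i j k l : Fin 4) : Prop :=
  i ≠ j ∧ i ≠ k ∧ i ≠ l ∧ j ≠ k ∧ j ≠ l ∧ k ≠ l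

/-- The 13 classes: the six `(-1)`-curves `g_{ij}`, the three `(-1)`-curves
`h - g_{ij} - g_{kl}` for partitions `{1,2,3,4} = {i,j} ⊔ {k,l}`, and the four
`(-2)`-curves `h - g_{ij} - g_{ik} - g_{il}`. -/
def Sigma7 : Set (Fin 7 → ℝ) :=
  {v | (∃ i j : Fin 4, i ≠ j ∧ v = g i j) ∨
       (∃ i j k l : Fin 4, Distinct4 i j k l ∧ v = h7 - g i j - g k l) ∨
       (∃ i j k l : Fin 4, Distinct4 i j k l ∧ v = h7 - g i j - g i k - g i l)}

/-- The 38 semiample classes on `F`. -/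
def Xi7 : Set (Fin 7 → ℝ) :=
  {v | v = h7 ∨
       (∃ i j : Fin 4, i ≠ j ∧ v = h7 - g i j) ∨
       (∃ i j k : Fin 4, i ≠ j ∧ i ≠ k ∧ j ≠ k ∧
          v = (2 : ℝ) • h7 - g i j - g i k - g j k) ∨
       (∃ i j k l : Fin 4, Distinct4 i j k l ∧
          v = (2 : ℝ) • h7 - g i j - g j k - g k l) ∨
       (∃ i j k l : Fin 4, Distinct4 i j k l ∧
          v = (2 : ℝ) • h7 - g i j - g j k - g k l - g i l) ∨
       (∃ i j k l : Fin 4, Distinct4 i j k l ∧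
          v = (3 : ℝ) • h7 - (2 : ℝ) • g i j - g i k - g j k - g k l)}

/-- The convex cone generated by a set: all finite nonnegative combinations. -/
def coneGen (S : Set (Fin 7 → ℝ)) : Set (Fin 7 → ℝ) :=
  {v | ∃ (n : ℕ) (c : Fin n → ℝ) (x : Fin n → (Fin 7 → ℝ)),
      (∀ t, 0 ≤ c t) ∧ (∀ t, x t ∈ S) ∧ v = ∑ t, c t • x t}

open PointedCone

/-- **Farkas' lemma** for a finite family of vectors: a vector outside the cone they generate is
separated from that cone by a linear functional. -/
theorem mem_hull_or_exists_separating {ι V : Type*} [AddCommGroup V] [Module ℝ V]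
    (s : Finset ι) (v : ι → V) (x : V) :
    x ∈ hull ℝ (v '' s) ∨ ∃ f : V →ₗ[ℝ] ℝ, (∀ i ∈ s, 0 ≤ f (v i)) ∧ f x < 0 := by
  classical
  induction s using Finset.induction_on generalizing v x with
  | empty =>
    by_cases hx : x = 0
    · simp [hx]
    · obtain ⟨f, hf⟩ := Module.Projective.exists_dual_eq_one ℝ hx
      exact Or.inr ⟨-f, by simp, by simp [hf]⟩
  | insert a s _ ih =>
    have hsub : hull ℝ (v '' s) ≤ hull ℝ (v '' (insert a s : Finset ι)) :=
      Submodule.span_mono (Set.image_mono (by simp))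
    have ha : v a ∈ hull ℝ (v '' (insert a s : Finset ι)) :=
      subset_hull (Set.mem_image_of_mem v (by simp))
    obtain hx | ⟨f, hf, hfx⟩ := ih v x
    · exact Or.inl (hsub hx)
    by_cases hfa : 0 ≤ f (v a)
    · exact Or.inr ⟨f, by simpa [hfa] using hf, hfx⟩
    push Not at hfa
    -- the projection onto the kernel of `f` along `v a`
    let P : V →ₗ[ℝ] V := LinearMap.id - (f.smulRight ((f (v a))⁻¹ • v a))
    have hP (y : V) : P y = y - (f y / f (v a)) • v a := by
      simp [P, smul_smul, div_eq_mul_inv]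
    obtain hx | ⟨f', hf', hfx'⟩ := ih (P ∘ v) (P x)
    · left
      have hle : hull ℝ ((P ∘ v) '' s) ≤ hull ℝ (v '' (insert a s : Finset ι)) := by
        refine Submodule.span_le.2 ?_
        rintro _ ⟨i, hi, rfl⟩
        have hc : 0 ≤ -(f (v i) / f (v a)) :=
          neg_nonneg.2 (div_nonpos_of_nonneg_of_nonpos (hf i hi) hfa.le)
        have := add_mem (hsub (subset_hull (Set.mem_image_of_mem v hi)))
          (PointedCone.smul_mem _ hc ha)
        simpa [hP, sub_eq_add_neg] using this
      have := add_mem (hle hx)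
        (PointedCone.smul_mem _ (div_nonneg_of_nonpos hfx.le hfa.le) ha)
      simpa [hP] using this
    · refine Or.inr ⟨f' ∘ₗ P, ?_, hfx'⟩
      have : P (v a) = 0 := by simp [hP, hfa.ne]
      simpa [this] using hf'

theorem coneGen_eq_hull (S : Set (Fin 7 → ℝ)) : coneGen S = hull ℝ S := by
  ext v
  simp only [SetLike.mem_coe, Submodule.mem_span_set']
  constructor
  · rintro ⟨n, c, x, hc, hx, rfl⟩
    exact ⟨n, fun t ↦ ⟨c t, hc t⟩, fun t ↦ ⟨x t, hx t⟩, rfl⟩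
  · rintro ⟨n, c, x, rfl⟩
    exact ⟨n, fun t ↦ c t, fun t ↦ x t, fun t ↦ (c t).2, fun t ↦ (x t).2, rfl⟩

theorem q7_comm (v w : Fin 7 → ℝ) : q7 v w = q7 w v := by
  simp only [q7]; ring

/-- The intersection form is nondegenerate: every linear functional is a pairing with a class. -/
theorem exists_eq_q7 (f : (Fin 7 → ℝ) →ₗ[ℝ] ℝ) : ∃ w, ∀ v, f v = q7 v w := by
  refine ⟨fun n ↦ if n = 0 then f (Pi.single n 1) else -f (Pi.single n 1), fun v ↦ ?_⟩
  conv_lhs => rw [← Finset.univ_sum_single v, map_sum]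
  have hf (n : Fin 7) : f (Pi.single n (v n)) = v n * f (Pi.single n 1) := by
    rw [← smul_eq_mul, ← map_smul, ← Pi.single_smul, smul_eq_mul, mul_one]
  simp [hf, Fin.sum_univ_seven, q7]

theorem q7_nonneg_of_mem_hull {S : Set (Fin 7 → ℝ)} {v w : Fin 7 → ℝ}
    (hw : ∀ s ∈ S, 0 ≤ q7 s w) (hv : v ∈ hull ℝ S) : 0 ≤ q7 v w := by
  induction hv using Submodule.span_induction with
  | mem s hs => exact hw s hs
  | zero => simp [q7]
  | add x y _ _ hx hy =>
    have : q7 (x + y) w = q7 x w + q7 y w := by simp only [q7, Pi.add_apply]; ring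
    exact this ▸ add_nonneg hx hy
  | smul c x _ hx =>
    have : q7 (c • x) w = c * q7 x w := by
      simp only [q7, Pi.smul_apply, ← Nonneg.coe_smul, smul_eq_mul]; ring
    exact this ▸ mul_nonneg c.2 hx

theorem mem_hull_of_forall_q7_nonneg {S : Set (Fin 7 → ℝ)} (hS : S.Finite) {v : Fin 7 → ℝ}
    (hv : ∀ w, (∀ s ∈ S, 0 ≤ q7 s w) → 0 ≤ q7 v w) : v ∈ hull ℝ S := by
  obtain h | ⟨f, hf, hfv⟩ := mem_hull_or_exists_separating hS.toFinset id v
  · simpa using h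
  · obtain ⟨w, hw⟩ := exists_eq_q7 f
    simp only [hw] at hf hfv
    exact absurd (hv w (by simpa using hf)) hfv.not_ge

theorem finite_Xi7 : Xi7.Finite := by
  let F : Fin 4 × Fin 4 × Fin 4 × Fin 4 → Set (Fin 7 → ℝ) := fun ⟨i, j, k, l⟩ ↦
    {h7, h7 - g i j, (2 : ℝ) • h7 - g i j - g i k - g j k,
      (2 : ℝ) • h7 - g i j - g j k - g k l, (2 : ℝ) • h7 - g i j - g j k - g k l - g i l,
      (3 : ℝ) • h7 - (2 : ℝ) • g i j - g i k - g j k - g k l}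
  refine (Set.finite_iUnion fun p ↦ (by simp [F] : (F p).Finite)).subset ?_
  intro v hv
  simp only [Set.mem_iUnion, Prod.exists]
  obtain h | ⟨i, j, -, h⟩ | ⟨i, j, k, -, -, -, h⟩ | ⟨i, j, k, l, -, h⟩ | ⟨i, j, k, l, -, h⟩ |
    ⟨i, j, k, l, -, h⟩ := hv
  · exact ⟨0, 0, 0, 0, by simp [F, h]⟩
  · exact ⟨i, j, 0, 0, by simp [F, h]⟩
  · exact ⟨i, j, k, 0, by simp [F, h]⟩
  all_goals exact ⟨i, j, k, l, by simp [F, h]⟩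

theorem exists_max_three (x y z : ℝ) :
    ∃ d, (x ≤ d ∧ y ≤ d ∧ z ≤ d) ∧ (d = x ∨ d = y ∨ d = z) := by
  refine ⟨max x (max y z), by simp, ?_⟩
  rcases max_choice x (max y z) with h | h <;> rcases max_choice y z with h' | h' <;> rw [h] <;>
    tauto

/-- Inequalities in coordinates that make a class nonnegative on `Sigma7`. -/
theorem q7_nonneg_of_mem_Sigma7 {w : Fin 7 → ℝ} (h0 : ∀ n, n ≠ 0 → w n ≤ 0)
    (hm : 0 ≤ w 0 + w 1 + w 6 ∧ 0 ≤ w 0 + w 2 + w 5 ∧ 0 ≤ w 0 + w 3 + w 4)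
    (hs : 0 ≤ w 0 + w 1 + w 2 + w 3 ∧ 0 ≤ w 0 + w 1 + w 4 + w 5 ∧
      0 ≤ w 0 + w 2 + w 4 + w 6 ∧ 0 ≤ w 0 + w 3 + w 5 + w 6) :
    ∀ s ∈ Sigma7, 0 ≤ q7 s w := by
  rintro s (⟨i, j, hd, rfl⟩ | ⟨i, j, k, l, hd, rfl⟩ | ⟨i, j, k, l, hd, rfl⟩)
  · have := h0 1; have := h0 2; have := h0 3; have := h0 4; have := h0 5; have := h0 6
    fin_cases i <;> fin_cases j <;> simp_all [q7, g, gIdx]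
  all_goals
    fin_cases i <;> fin_cases j <;> simp [Distinct4] at hd <;>
    fin_cases k <;> fin_cases l <;> simp at hd <;>
    simp [q7, g, gIdx, h7] <;> linarith

set_option maxHeartbeats 2000000 in
theorem q7_Sigma7_Xi7_nonneg {s ξ : Fin 7 → ℝ} (hs : s ∈ Sigma7) (hξ : ξ ∈ Xi7) :
    0 ≤ q7 s ξ := by
  have key : (∀ n, n ≠ 0 → ξ n ≤ 0) ∧
      (0 ≤ ξ 0 + ξ 1 + ξ 6 ∧ 0 ≤ ξ 0 + ξ 2 + ξ 5 ∧ 0 ≤ ξ 0 + ξ 3 + ξ 4) ∧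
      0 ≤ ξ 0 + ξ 1 + ξ 2 + ξ 3 ∧ 0 ≤ ξ 0 + ξ 1 + ξ 4 + ξ 5 ∧
      0 ≤ ξ 0 + ξ 2 + ξ 4 + ξ 6 ∧ 0 ≤ ξ 0 + ξ 3 + ξ 5 + ξ 6 := by
    obtain rfl | ⟨i, j, hd, rfl⟩ | ⟨i, j, k, hij, hik, hjk, rfl⟩ | ⟨i, j, k, l, hd, rfl⟩ |
      ⟨i, j, k, l, hd, rfl⟩ | ⟨i, j, k, l, hd, rfl⟩ := hξ
    · simp [Fin.forall_fin_succ, h7]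
    · fin_cases i <;> fin_cases j <;> simp at hd <;> simp [Fin.forall_fin_succ, g, gIdx, h7]
    · fin_cases i <;> fin_cases j <;> simp at hij <;> fin_cases k <;> simp at hik hjk <;>
        simp [Fin.forall_fin_succ, g, gIdx, h7] <;> norm_num
    all_goals
      fin_cases i <;> fin_cases j <;> simp [Distinct4] at hd <;>
      fin_cases k <;> fin_cases l <;> simp at hd <;>
      simp [Fin.forall_fin_succ, g, gIdx, h7] <;> norm_num
  exact q7_nonneg_of_mem_Sigma7 key.1 key.2.1 key.2.2 s hs

set_option maxHeartbeats 1000000 in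
/-- A class that is nonnegative on `Xi7` has the coefficients of a combination of the seven
nonexceptional classes in `Sigma7` from which it differs by exceptional classes. -/
theorem exists_cover_of_q7_Xi7_nonneg {v : Fin 7 → ℝ} (hv : ∀ ξ ∈ Xi7, 0 ≤ q7 v ξ) :
    ∃ e₀ e₁ e₂ e₃ d₁ d₂ d₃ : ℝ,
      (0 ≤ e₀ ∧ 0 ≤ e₁ ∧ 0 ≤ e₂ ∧ 0 ≤ e₃) ∧ (0 ≤ d₁ ∧ 0 ≤ d₂ ∧ 0 ≤ d₃) ∧
      e₀ + e₁ + e₂ + e₃ + d₁ + d₂ + d₃ = v 0 ∧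
      (0 ≤ v 1 + e₀ + e₁ + d₁ ∧ 0 ≤ v 6 + e₂ + e₃ + d₁) ∧
      (0 ≤ v 2 + e₀ + e₂ + d₂ ∧ 0 ≤ v 5 + e₁ + e₃ + d₂) ∧
      (0 ≤ v 3 + e₀ + e₃ + d₃ ∧ 0 ≤ v 4 + e₁ + e₂ + d₃) := by
  have edge (i j : Fin 4) (hd : i ≠ j) := hv _ (.inr <| .inl ⟨i, j, hd, rfl⟩)
  have triangle (i j k : Fin 4) (hij : i ≠ j) (hik : i ≠ k) (hjk : j ≠ k) :=
    hv _ (.inr <| .inr <| .inl ⟨i, j, k, hij, hik, hjk, rfl⟩)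
  have path (i j k l : Fin 4) (hd : Distinct4 i j k l) :=
    hv _ (.inr <| .inr <| .inr <| .inl ⟨i, j, k, l, hd, rfl⟩)
  have cycle (i j k l : Fin 4) (hd : Distinct4 i j k l) :=
    hv _ (.inr <| .inr <| .inr <| .inr <| .inl ⟨i, j, k, l, hd, rfl⟩)
  have kite (i j k l : Fin 4) (hd : Distinct4 i j k l) :=
    hv _ (.inr <| .inr <| .inr <| .inr <| .inr ⟨i, j, k, l, hd, rfl⟩)
  have h0 := hv _ (.inl rfl)
  have e01 := edge 0 1 (by decide)
  have e02 := edge 0 2 (by decide)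
  have e03 := edge 0 3 (by decide)
  have e12 := edge 1 2 (by decide)
  have e13 := edge 1 3 (by decide)
  have e23 := edge 2 3 (by decide)
  have t012 := triangle 0 1 2 (by decide) (by decide) (by decide)
  have t013 := triangle 0 1 3 (by decide) (by decide) (by decide)
  have t023 := triangle 0 2 3 (by decide) (by decide) (by decide)
  have t123 := triangle 1 2 3 (by decide) (by decide) (by decide)
  have p0123 := path 0 1 2 3 (by simp [Distinct4])
  have p0132 := path 0 1 3 2 (by simp [Distinct4])
  have p0213 := path 0 2 1 3 (by simp [Distinct4])
  have p0231 := path 0 2 3 1 (by simp [Distinct4])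
  have p0312 := path 0 3 1 2 (by simp [Distinct4])
  have p0321 := path 0 3 2 1 (by simp [Distinct4])
  have p1023 := path 1 0 2 3 (by simp [Distinct4])
  have p1032 := path 1 0 3 2 (by simp [Distinct4])
  have p1203 := path 1 2 0 3 (by simp [Distinct4])
  have p1302 := path 1 3 0 2 (by simp [Distinct4])
  have p2013 := path 2 0 1 3 (by simp [Distinct4])
  have p2103 := path 2 1 0 3 (by simp [Distinct4])
  have c0123 := cycle 0 1 2 3 (by simp [Distinct4])
  have c0132 := cycle 0 1 3 2 (by simp [Distinct4])
  have c0213 := cycle 0 2 1 3 (by simp [Distinct4])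
  have k0123 := kite 0 1 2 3 (by simp [Distinct4])
  have k0132 := kite 0 1 3 2 (by simp [Distinct4])
  have k0213 := kite 0 2 1 3 (by simp [Distinct4])
  have k0231 := kite 0 2 3 1 (by simp [Distinct4])
  have k0312 := kite 0 3 1 2 (by simp [Distinct4])
  have k0321 := kite 0 3 2 1 (by simp [Distinct4])
  have k1203 := kite 1 2 0 3 (by simp [Distinct4])
  have k1230 := kite 1 2 3 0 (by simp [Distinct4])
  have k1302 := kite 1 3 0 2 (by simp [Distinct4])
  have k1320 := kite 1 3 2 0 (by simp [Distinct4])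
  have k2301 := kite 2 3 0 1 (by simp [Distinct4])
  have k2310 := kite 2 3 1 0 (by simp [Distinct4])
  simp [q7, g, gIdx, h7] at h0 e01 e02 e03 e12 e13 e23 t012 t013 t023 t123 c0123 c0132 c0213
  simp [q7, g, gIdx, h7] at p0123 p0132 p0213 p0231 p0312 p0321 p1023 p1032 p1203 p1302 p2013 p2103
  simp [q7, g, gIdx, h7] at k0123 k0132 k0213 k0231 k0312 k0321 k1203 k1230 k1302 k1320 k2301 k2310
  clear hv edge triangle path cycle kite
  obtain ⟨e₀, hl0, hu0⟩ := exists_between_of_forall_le (α := ℝ)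
    (s := {-v 0 - v 2 - v 3, -v 0 - v 1 - v 3, -v 0 - v 1 - v 2, (-v 0 - v 1 - v 2 - v 3) / 2, 0})
    (t := {(3 * v 0 + v 3 + 2 * v 4 + v 5 + v 6) / 2, (3 * v 0 + v 2 + v 4 + 2 * v 5 + v 6) / 2,
         (3 * v 0 + v 1 + v 4 + v 5 + 2 * v 6) / 2, (2 * v 0 + v 4 + v 5 + v 6) / 2,
         2 * v 0 + v 3 + v 4 + v 6, 2 * v 0 + v 3 + v 4 + v 5, 2 * v 0 + v 2 + v 5 + v 6,
         2 * v 0 + v 2 + v 4 + v 5, 2 * v 0 + v 1 + v 5 + v 6, 2 * v 0 + v 1 + v 4 + v 6, v 0,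
         v 0 + v 6, v 0 + v 5, v 0 + v 4})
    (Set.insert_nonempty _ _) (Set.insert_nonempty _ _) (by
      simp only [Set.forall_mem_insert, Set.mem_singleton_iff, forall_eq]
      repeat' apply And.intro
      all_goals linarith)
  simp only [mem_upperBounds, mem_lowerBounds, Set.forall_mem_insert, Set.mem_singleton_iff,
    forall_eq] at hl0 hu0
  obtain ⟨e₁, hl1, hu1⟩ := exists_between_of_forall_le (α := ℝ)
    (s := {e₀ - v 0 - v 4 - v 5, -v 0 - v 1 - v 5, -v 0 - v 1 - v 4, (-v 0 - v 1 - v 4 - v 5) / 2, 0})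
    (t := {2 * v 0 + v 3 + v 4 + v 6 - e₀, 2 * v 0 + v 2 + v 5 + v 6 - e₀, v 0 - e₀, v 0 + v 6 - e₀,
         v 0 + v 3, v 0 + v 2, v 0 + v 2 + v 3 + e₀})
    (Set.insert_nonempty _ _) (Set.insert_nonempty _ _) (by
      simp only [Set.forall_mem_insert, Set.mem_singleton_iff, forall_eq]
      repeat' apply And.intro
      all_goals linarith)
  simp only [mem_upperBounds, mem_lowerBounds, Set.forall_mem_insert, Set.mem_singleton_iff,
    forall_eq] at hl1 hu1
  obtain ⟨e₂, hl2, hu2⟩ := exists_between_of_forall_le (α := ℝ)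
    (s := {e₀ - v 0 - v 4 - v 6, e₁ - v 0 - v 2 - v 6, -v 0 - v 2 - v 4,
         (-v 0 - v 2 - v 4 - v 6) / 2, -v 0 - v 1 - v 2 - v 4 - e₀ - e₁, 0})
    (t := {v 0 - e₀ - e₁, v 0 + v 5 - e₀, v 0 + v 3 - e₁, v 0 + v 1, v 0 + v 1 + v 5 + e₁,
         v 0 + v 1 + v 3 + e₀})
    (Set.insert_nonempty _ _) (Set.insert_nonempty _ _) (by
      simp only [Set.forall_mem_insert, Set.mem_singleton_iff, forall_eq]
      repeat' apply And.intro
      all_goals linarith)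
  simp only [mem_upperBounds, mem_lowerBounds, Set.forall_mem_insert, Set.mem_singleton_iff,
    forall_eq] at hl2 hu2
  obtain ⟨e₃, hl3, hu3⟩ := exists_between_of_forall_le (α := ℝ)
    (s := {e₀ - v 0 - v 5 - v 6, e₀ - v 0 - v 4 - v 5 - v 6 - e₁ - e₂, e₁ - v 0 - v 3 - v 6,
         e₂ - v 0 - v 3 - v 5, (-v 0 - v 3 - v 5 - v 6) / 2,
         e₁ - v 0 - v 2 - v 3 - v 6 - e₀ - e₂, e₂ - v 0 - v 1 - v 3 - v 5 - e₀ - e₁, 0})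
    (t := {v 0 - e₀ - e₁ - e₂, v 0 + v 4 - e₀, v 0 + v 2 - e₁, v 0 + v 2 + v 4 + e₂, v 0 + v 1 - e₂,
         v 0 + v 1 + v 4 + e₁, v 0 + v 1 + v 2 + e₀, v 0 + v 1 + v 2 + v 4 + e₀ + e₁ + e₂})
    (Set.insert_nonempty _ _) (Set.insert_nonempty _ _) (by
      simp only [Set.forall_mem_insert, Set.mem_singleton_iff, forall_eq]
      repeat' apply And.intro
      all_goals linarith)
  simp only [mem_upperBounds, mem_lowerBounds, Set.forall_mem_insert, Set.mem_singleton_iff,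
    forall_eq] at hl3 hu3
  obtain ⟨d₂, h₂, h₂'⟩ : ∃ d, (0 ≤ d ∧ -v 2 - e₀ - e₂ ≤ d ∧ -v 5 - e₁ - e₃ ≤ d) ∧
      (d = 0 ∨ d = -v 2 - e₀ - e₂ ∨ d = -v 5 - e₁ - e₃) :=
    exists_max_three _ _ _
  obtain ⟨d₃, h₃, h₃'⟩ : ∃ d, (0 ≤ d ∧ -v 3 - e₀ - e₃ ≤ d ∧ -v 4 - e₁ - e₂ ≤ d) ∧
      (d = 0 ∨ d = -v 3 - e₀ - e₃ ∨ d = -v 4 - e₁ - e₂) :=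
    exists_max_three _ _ _
  refine ⟨e₀, e₁, e₂, e₃, v 0 - e₀ - e₁ - e₂ - e₃ - d₂ - d₃, d₂, d₃, ?_⟩
  have key : 0 ≤ v 0 - e₀ - e₁ - e₂ - e₃ - d₂ - d₃ ∧ 0 ≤ v 0 - e₂ - e₃ - d₂ - d₃ + v 1 ∧
      0 ≤ v 0 - e₀ - e₁ - d₂ - d₃ + v 6 := by
    rcases h₂' with rfl | rfl | rfl <;> rcases h₃' with rfl | rfl | rfl <;>
      refine ⟨?_, ?_, ?_⟩ <;> linarith
  refine ⟨⟨?_, ?_, ?_, ?_⟩, ⟨?_, ?_, ?_⟩, ?_, ⟨?_, ?_⟩, ⟨?_, ?_⟩, ?_, ?_⟩ <;> linarith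

theorem mem_hull_Sigma7 {v : Fin 7 → ℝ} (hv : ∀ ξ ∈ Xi7, 0 ≤ q7 v ξ) : v ∈ hull ℝ Sigma7 := by
  obtain ⟨e₀, e₁, e₂, e₃, d₁, d₂, d₃, ⟨he₀, he₁, he₂, he₃⟩, ⟨hd₁, hd₂, hd₃⟩, hsum,
    ⟨h₁, h₆⟩, ⟨h₂, h₅⟩, h₃, h₄⟩ := exists_cover_of_q7_Xi7_nonneg hv
  have point (c : ℝ) (hc : 0 ≤ c) (i j : Fin 4) (hd : i ≠ j) :
      c • g i j ∈ hull ℝ Sigma7 :=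
    PointedCone.smul_mem _ hc (subset_hull (.inl ⟨i, j, hd, rfl⟩))
  have diagonal (c : ℝ) (hc : 0 ≤ c) (i j k l : Fin 4) (hd : Distinct4 i j k l) :
      c • (h7 - g i j - g k l) ∈ hull ℝ Sigma7 :=
    PointedCone.smul_mem _ hc (subset_hull (.inr <| .inl ⟨i, j, k, l, hd, rfl⟩))
  have line (c : ℝ) (hc : 0 ≤ c) (i j k l : Fin 4) (hd : Distinct4 i j k l) :
      c • (h7 - g i j - g i k - g i l) ∈ hull ℝ Sigma7 :=
    PointedCone.smul_mem _ hc (subset_hull (.inr <| .inr ⟨i, j, k, l, hd, rfl⟩))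
  have hlines := add_mem (add_mem (line e₀ he₀ 0 1 2 3 (by simp [Distinct4]))
    (line e₁ he₁ 1 0 2 3 (by simp [Distinct4]))) (add_mem
    (line e₂ he₂ 2 0 1 3 (by simp [Distinct4])) (line e₃ he₃ 3 0 1 2 (by simp [Distinct4])))
  have hdiagonals := add_mem (add_mem (diagonal d₁ hd₁ 0 1 2 3 (by simp [Distinct4]))
    (diagonal d₂ hd₂ 0 2 1 3 (by simp [Distinct4]))) (diagonal d₃ hd₃ 0 3 1 2 (by simp [Distinct4]))
  have hpoints := add_mem (add_mem (add_mem (point _ h₁ 0 1 (by decide))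
    (point _ h₆ 2 3 (by decide))) (add_mem (point _ h₂ 0 2 (by decide))
    (point _ h₅ 1 3 (by decide)))) (add_mem (point _ h₃ 0 3 (by decide))
    (point _ h₄ 1 2 (by decide)))
  convert add_mem (add_mem hlines hdiagonals) hpoints using 1
  ext n
  fin_cases n <;> simp [g, gIdx, h7] <;> linarith

theorem cones_dual_Fsigma :
    coneGen Sigma7 = {v | ∀ ξ ∈ Xi7, 0 ≤ q7 v ξ} ∧
    coneGen Xi7 = {v | ∀ s ∈ Sigma7, 0 ≤ q7 v s} := by
  rw [coneGen_eq_hull, coneGen_eq_hull]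
  refine ⟨Set.Subset.antisymm ?_ fun v hv ↦ mem_hull_Sigma7 hv,
    Set.Subset.antisymm ?_ fun v hv ↦ ?_⟩
  · exact fun v hv ξ hξ ↦ q7_nonneg_of_mem_hull (fun s hs ↦ q7_Sigma7_Xi7_nonneg hs hξ) hv
  · exact fun v hv s hs ↦ q7_nonneg_of_mem_hull
      (fun ξ hξ ↦ q7_comm s ξ ▸ q7_Sigma7_Xi7_nonneg hs hξ) hv
  · refine mem_hull_of_forall_q7_nonneg finite_Xi7 fun w hw ↦ ?_
    rw [q7_comm]
    refine q7_nonneg_of_mem_hull (fun s hs ↦ q7_comm v s ▸ hv s hs)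
      (mem_hull_Sigma7 fun ξ hξ ↦ q7_comm ξ w ▸ hw ξ hξ)
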